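/- Let X be a finite-dimensional Hilbert space and g : X → ℝ ∪ {+∞} a proper lower semicontinuous function that is prox-regular and subdifferentially continuous at x̄ for v̂ ∈ ∂g(x̄), with threshold of prox-regularity ℛ. Define τ₀ := inf{ ⟨z,w⟩/‖w‖² : z ∈ D*(∂g)(x̄,v̂)(w), w ≠ 0 }. Then: (i) τ₀ > −∞; and (ii) ℛ = max{0, −τ₀}. -/

import Mathlib

noncomputable section

open Filter Topology Metric Set MeasureTheory
open scoped RealInnerProductSpace Pointwise

namespace PVS

variable {X : Type*} [NormedAddCommGroup X] [InnerProductSpace ℝ X]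
variable {Y : Type*} [NormedAddCommGroup Y] [InnerProductSpace ℝ Y]
variable {W : Type*} [NormedAddCommGroup W] [InnerProductSpace ℝ W]
variable {P : Type*} [MetricSpace P]
variable {Q : Type*} [MetricSpace Q]

/-- Regular (Fréchet) subdifferential of an extended-real-valued function. -/
def regSubdiff (h : X → EReal) (x : X) : Set X :=
  {v | h x ≠ ⊤ ∧ h x ≠ ⊥ ∧ ∀ ε > (0:ℝ), ∀ᶠ u in 𝓝 x,
      h x + ((⟪v, u - x⟫ - ε * ‖u - x‖ : ℝ) : EReal) ≤ h u}

/-- Weak sequential convergence in an inner product space. -/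
def WeakTendsto (xs : ℕ → X) (x : X) : Prop :=
  ∀ z : X, Tendsto (fun k => ⟪xs k, z⟫) atTop (𝓝 ⟪x, z⟫)

/-- Limiting (Mordukhovich) subdifferential. -/
def limSubdiff (h : X → EReal) (x : X) : Set X :=
  {v | ∃ xs vs : ℕ → X, Tendsto xs atTop (𝓝 x) ∧
      Tendsto (fun k => h (xs k)) atTop (𝓝 (h x)) ∧
      (∀ k, vs k ∈ regSubdiff h (xs k)) ∧ WeakTendsto vs v}

/-- Partial limiting subdifferential with respect to the first variable. -/
def pSubdiff {PP : Type*} (g : X → PP → EReal) (x : X) (p : PP) : Set X :=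
  limSubdiff (fun x' => g x' p) x

/-- Graph of a set-valued map. -/
def gph (F : X → Set Y) : Set (X × Y) := {t | t.2 ∈ F t.1}

/-- Regular normal cone. -/
def regNC (Ω : Set X) (x : X) : Set X :=
  {v | ∀ ε > (0:ℝ), ∀ᶠ y in 𝓝[Ω] x, ⟪v, y - x⟫ ≤ ε * ‖y - x‖}

/-- Limiting normal cone. -/
def limNC (Ω : Set X) (x : X) : Set X :=
  {v | ∃ xs vs : ℕ → X, (∀ k, xs k ∈ Ω) ∧ Tendsto xs atTop (𝓝 x) ∧
      (∀ k, vs k ∈ regNC Ω (xs k)) ∧ Tendsto vs atTop (𝓝 v)}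

/-- Regular normal cone to a subset of a product of two inner product spaces,
with the Euclidean product norm. -/
def regNC2 (Ω : Set (X × Y)) (ω : X × Y) : Set (X × Y) :=
  {ζ | ∀ ε > (0:ℝ), ∀ᶠ y in 𝓝[Ω] ω,
      ⟪ζ.1, y.1 - ω.1⟫ + ⟪ζ.2, y.2 - ω.2⟫
        ≤ ε * Real.sqrt (‖y.1 - ω.1‖ ^ 2 + ‖y.2 - ω.2‖ ^ 2)}

/-- Limiting normal cone in a product of two spaces. -/
def limNC2 (Ω : Set (X × Y)) (ω : X × Y) : Set (X × Y) :=
  {ζ | ∃ ωs ζs : ℕ → X × Y, (∀ k, ωs k ∈ Ω) ∧ Tendsto ωs atTop (𝓝 ω) ∧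
      (∀ k, ζs k ∈ regNC2 Ω (ωs k)) ∧ Tendsto ζs atTop (𝓝 ζ)}

/-- Regular coderivative of a set-valued map. -/
def regCoderiv (F : X → Set Y) (u : X) (v : Y) (w : Y) : Set X :=
  {z | (z, -w) ∈ regNC2 (gph F) (u, v)}

/-- Limiting coderivative of a set-valued map. -/
def limCoderiv (F : X → Set Y) (u : X) (v : Y) (w : Y) : Set X :=
  {z | (z, -w) ∈ limNC2 (gph F) (u, v)}

/-- Regular normal cone in a product of three inner product spaces. -/
def regNC3 (Ω : Set (X × W × Y)) (ω : X × W × Y) : Set (X × W × Y) :=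
  {ζ | ∀ ε > (0:ℝ), ∀ᶠ y in 𝓝[Ω] ω,
      ⟪ζ.1, y.1 - ω.1⟫ + ⟪ζ.2.1, y.2.1 - ω.2.1⟫ + ⟪ζ.2.2, y.2.2 - ω.2.2⟫
        ≤ ε * Real.sqrt (‖y.1 - ω.1‖ ^ 2 + ‖y.2.1 - ω.2.1‖ ^ 2 + ‖y.2.2 - ω.2.2‖ ^ 2)}

/-- Limiting normal cone in a product of three inner product spaces. -/
def limNC3 (Ω : Set (X × W × Y)) (ω : X × W × Y) : Set (X × W × Y) :=
  {ζ | ∃ ωs ζs : ℕ → X × W × Y, (∀ k, ωs k ∈ Ω) ∧ Tendsto ωs atTop (𝓝 ω) ∧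
      (∀ k, ζs k ∈ regNC3 Ω (ωs k)) ∧ Tendsto ζs atTop (𝓝 ζ)}

/-- Limiting coderivative of the full partial subdifferential map (x,p) ↦ ∂ₓ g(x,p). -/
def limCoderivFull (g : X → W → EReal) (xb : X) (pb : W) (vh : X) (w : X) : Set (X × W) :=
  {zs | (zs.1, zs.2, -w) ∈ limNC3 {t : X × W × X | t.2.2 ∈ pSubdiff g t.1 t.2.1} (xb, pb, vh)}

/-- Lipschitz-like (Aubin) property of a set-valued map around a graph point. -/
def LipschitzLike {α Z : Type*} [MetricSpace α] [SeminormedAddCommGroup Z]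
    (F : α → Set Z) (ab : α) (zb : Z) : Prop :=
  ∃ ℓ > (0:ℝ), ∃ U ∈ 𝓝 ab, ∃ V ∈ 𝓝 zb,
    ∀ a ∈ U, ∀ a' ∈ U, ∀ z ∈ F a ∩ V, ∃ z' ∈ F a', ‖z - z'‖ ≤ ℓ * dist a a'

/-- Epigraph of g(·,p). -/
def epi {PP : Type*} (g : X → PP → EReal) (p : PP) : Set (X × ℝ) :=
  {q | g q.1 p ≤ (q.2 : EReal)}

/-- (A1): Lipschitz continuity of the base around the reference point. -/
def A1 (f : X → P → Q → X) (xb : X) (pb : P) (qb : Q) : Prop :=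
  ∃ L > (0:ℝ), ∃ ε > (0:ℝ), ∀ x₁ x₂ p₁ p₂ q₁ q₂,
    ‖x₁ - xb‖ < ε → ‖x₂ - xb‖ < ε → dist p₁ pb < ε → dist p₂ pb < ε →
    dist q₁ qb < ε → dist q₂ qb < ε →
    ‖f x₁ p₁ q₁ - f x₂ p₂ q₂‖ ≤ L * (‖x₁ - x₂‖ + dist p₁ p₂ + dist q₁ q₂)

/-- Parametric prox-regularity with prox-parameter r. -/
def ProxRegWith (g : X → P → EReal) (xb : X) (pb : P) (vh : X) (r : ℝ) : Prop :=
  ∃ ε > (0:ℝ), ∀ x u p v, ‖x - xb‖ < ε → ‖u - xb‖ < ε → dist p pb < ε → ‖v - vh‖ < ε →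
    v ∈ pSubdiff g u p →
    g u p + ((⟪v, x - u⟫ - r / 2 * ‖x - u‖ ^ 2 : ℝ) : EReal) ≤ g x p

/-- Subdifferential continuity with compatible parameterization. -/
def SubdiffCont (g : X → P → EReal) (xb : X) (pb : P) (vh : X) : Prop :=
  Tendsto (fun t : X × P × X => g t.1 t.2.1)
    (𝓝[{t : X × P × X | t.2.2 ∈ pSubdiff g t.1 t.2.1}] (xb, pb, vh)) (𝓝 (g xb pb))

/-- (A2): parametric continuous prox-regularity. -/
def A2 (g : X → P → EReal) (xb : X) (pb : P) (vh : X) : Prop :=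
  (∃ r > (0:ℝ), ProxRegWith g xb pb vh r) ∧ SubdiffCont g xb pb vh

/-- Threshold of prox-regularity. -/
def proxThreshold (g : X → P → EReal) (xb : X) (pb : P) (vh : X) : ℝ :=
  sInf {r : ℝ | 0 < r ∧ ProxRegWith g xb pb vh r}

/-- (A3): basic constraint qualification. -/
def A3 (g : X → P → EReal) (xb : X) (pb : P) : Prop :=
  LipschitzLike (fun p => epi g p) pb (xb, (g xb pb).toReal)

/-- (A4): uniform partial differentiability with partial Jacobian continuous at the point. -/
def A4 (f : X → P → Q → X) (Df : X → P → Q → X →L[ℝ] X) (xb : X) (pb : P) (qb : Q) : Prop :=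
  (∃ η > (0:ℝ), ∀ ε > (0:ℝ), ∃ δ > (0:ℝ), ∀ x p q,
      ‖x - xb‖ < η → dist p pb < η → dist q qb < η →
      ∀ x', ‖x' - x‖ < δ →
        ‖f x' p q - f x p q - Df x p q (x' - x)‖ ≤ ε * ‖x' - x‖) ∧
  Tendsto (fun t : X × P × Q => Df t.1 t.2.1 t.2.2) (𝓝 (xb, pb, qb)) (𝓝 (Df xb pb qb))

/-- Solution map of the parametric variational system. -/
def SolMap (f : X → P → Q → X) (g : X → P → EReal) (v : X) (p : P) (q : Q) : Set X :=
  {x | v - f x p q ∈ pSubdiff g x p}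

/-- Single-valued localization of a three-parametric solution map. -/
def Localizes3 (S : X → P → Q → Set X) (V : Set X) (Pn : Set P) (Qn : Set Q) (U : Set X)
    (ϑ : X → P → Q → X) : Prop :=
  ∀ v ∈ V, ∀ p ∈ Pn, ∀ q ∈ Qn,
    ϑ v p q ∈ U ∧ ϑ v p q ∈ S v p q ∧ ∀ x ∈ U, x ∈ S v p q → x = ϑ v p q

/-- Lipschitzian full stability. -/
def LipFullStable (S : X → P → Q → Set X) (xb vb : X) (pb : P) (qb : Q) : Prop :=
  ∃ V ∈ 𝓝 vb, ∃ Pn ∈ 𝓝 pb, ∃ Qn ∈ 𝓝 qb, ∃ U ∈ 𝓝 xb, ∃ ϑ : X → P → Q → X,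
    Localizes3 S V Pn Qn U ϑ ∧
    ∃ κ > (0:ℝ), ∃ ℓ > (0:ℝ), ∀ v₁ ∈ V, ∀ p₁ ∈ Pn, ∀ q₁ ∈ Qn, ∀ v₂ ∈ V, ∀ p₂ ∈ Pn, ∀ q₂ ∈ Qn,
      ‖(v₁ - v₂) - (2 * κ) • (ϑ v₁ p₁ q₁ - ϑ v₂ p₂ q₂)‖
        ≤ ‖v₁ - v₂‖ + ℓ * (dist p₁ p₂ + dist q₁ q₂)

/-- Hölderian full stability with given moduli. -/
def HolderFullStableWith (S : X → P → Q → Set X) (xb vb : X) (pb : P) (qb : Q) (κ ℓ : ℝ) : Prop :=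
  ∃ V ∈ 𝓝 vb, ∃ Pn ∈ 𝓝 pb, ∃ Qn ∈ 𝓝 qb, ∃ U ∈ 𝓝 xb, ∃ ϑ : X → P → Q → X,
    Localizes3 S V Pn Qn U ϑ ∧
    ∀ v₁ ∈ V, ∀ p₁ ∈ Pn, ∀ q₁ ∈ Qn, ∀ v₂ ∈ V, ∀ p₂ ∈ Pn, ∀ q₂ ∈ Qn,
      ‖(v₁ - v₂) - (2 * κ) • (ϑ v₁ p₁ q₁ - ϑ v₂ p₂ q₂)‖
        ≤ ‖v₁ - v₂‖ + ℓ * (Real.sqrt (dist p₁ p₂) + dist q₁ q₂)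

/-- Hölderian full stability. -/
def HolderFullStable (S : X → P → Q → Set X) (xb vb : X) (pb : P) (qb : Q) : Prop :=
  ∃ κ > (0:ℝ), ∃ ℓ > (0:ℝ), HolderFullStableWith S xb vb pb qb κ ℓ

/-- Neighborhood second-order condition via the regular coderivative of ∂g_p. -/
def SOC (g : X → P → EReal) (A : X →L[ℝ] X) (xb : X) (pb : P) (vh : X) (η κ₀ : ℝ) : Prop :=
  ∀ u p v, ‖u - xb‖ ≤ η → dist p pb ≤ η → ‖v - vh‖ ≤ η → v ∈ pSubdiff g u p →
    ∀ w z, z ∈ regCoderiv (fun y => pSubdiff g y p) u v w →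
      κ₀ * ‖w‖ ^ 2 ≤ ⟪A w, w⟫ + ⟪z, w⟫

/-- The graphical map p ↦ gph ∂ₓ g(·,p). -/
def gphMap (g : X → P → EReal) (p : P) : Set (X × X) := {t | t.2 ∈ pSubdiff g t.1 p}

/-- Local strong monotonicity of f in x with modulus σ. -/
def StrongMono (f : X → P → Q → X) (xb : X) (pb : P) (qb : Q) (σ : ℝ) : Prop :=
  ∃ ε > (0:ℝ), ∀ x₁ x₂ p q, ‖x₁ - xb‖ < ε → ‖x₂ - xb‖ < ε → dist p pb < ε → dist q qb < ε →
    σ * ‖x₁ - x₂‖ ^ 2 ≤ ⟪f x₁ p q - f x₂ p q, x₁ - x₂⟫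

/-- The proximal mapping P_λ(v,p) = {x : v ∈ x + λ ∂ₓ g(x,p)}. -/
def proxMap (g : X → P → EReal) (lam : ℝ) (v : X) (p : P) : Set X :=
  {x | ∃ s ∈ pSubdiff g x p, v = x + lam • s}

/-- Single-valued localization of a two-parametric solution map. -/
def Localizes2 (S : X → P → Set X) (V : Set X) (Pn : Set P) (U : Set X) (ϑ : X → P → X) : Prop :=
  ∀ v ∈ V, ∀ p ∈ Pn, ϑ v p ∈ U ∧ ϑ v p ∈ S v p ∧ ∀ x ∈ U, x ∈ S v p → x = ϑ v p

/-- (Lipschitzian) full stability of a two-parametric system. -/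
def FullStable2 (S : X → P → Set X) (xb vb : X) (pb : P) : Prop :=
  ∃ V ∈ 𝓝 vb, ∃ Pn ∈ 𝓝 pb, ∃ U ∈ 𝓝 xb, ∃ ϑ : X → P → X,
    Localizes2 S V Pn U ϑ ∧
    ∃ κ > (0:ℝ), ∃ ℓ > (0:ℝ), ∀ v₁ ∈ V, ∀ p₁ ∈ Pn, ∀ v₂ ∈ V, ∀ p₂ ∈ Pn,
      ‖(v₁ - v₂) - (2 * κ) • (ϑ v₁ p₁ - ϑ v₂ p₂)‖ ≤ ‖v₁ - v₂‖ + ℓ * dist p₁ p₂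

/-- Normal cone of convex analysis. -/
def convNC (C : Set X) (x : X) : Set X := {v | x ∈ C ∧ ∀ y ∈ C, ⟪v, y - x⟫ ≤ 0}

/-- Solution map of a parametric variational inequality. -/
def SolMapVI (f : X → P → X) (C : Set X) (v : X) (p : P) : Set X :=
  {x | v - f x p ∈ convNC C x}

/-- Radial cone. -/
def radialCone (C : Set X) (x : X) : Set X := {w | ∃ t > (0:ℝ), x + t • w ∈ C}

/-- Tangent cone (closure of the radial cone). -/
def tangentC (C : Set X) (x : X) : Set X := closure (radialCone C x)

/-- Critical cone. -/
def criticalCone (C : Set X) (x v : X) : Set X := tangentC C x ∩ {w | ⟪v, w⟫ = 0}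

/-- Polyhedricity of a closed convex set. -/
def Polyhedric (C : Set X) : Prop :=
  ∀ x ∈ C, ∀ v ∈ convNC C x,
    criticalCone C x v = closure (radialCone C x ∩ {w | ⟪v, w⟫ = 0})

/-- Weak sequential outer limit of critical cones. -/
def Hw (C : Set X) (xb vh : X) : Set X :=
  {w | ∃ xs vs ws : ℕ → X, (∀ k, vs k ∈ convNC C (xs k)) ∧
      Tendsto xs atTop (𝓝 xb) ∧ Tendsto vs atTop (𝓝 vh) ∧
      (∀ k, ws k ∈ criticalCone C (xs k) (vs k)) ∧ WeakTendsto ws w}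

/-- Strong sequential outer limit of critical cones. -/
def Hs (C : Set X) (xb vh : X) : Set X :=
  {w | ∃ xs vs ws : ℕ → X, (∀ k, vs k ∈ convNC C (xs k)) ∧
      Tendsto xs atTop (𝓝 xb) ∧ Tendsto vs atTop (𝓝 vh) ∧
      (∀ k, ws k ∈ criticalCone C (xs k) (vs k)) ∧ Tendsto ws atTop (𝓝 w)}

/-- Convex polyhedron: finite intersection of closed half-spaces. -/
def IsPolyhedron (C : Set X) : Prop :=
  ∃ (k : ℕ) (a : Fin k → X) (b : Fin k → ℝ), C = {x | ∀ i, ⟪a i, x⟫ ≤ b i}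

/-- Legendre form. -/
def LegendreForm (Qf : X → ℝ) : Prop :=
  (∃ A : X →L[ℝ] X, ∀ x, Qf x = ⟪A x, x⟫) ∧
  (∀ (xs : ℕ → X) (x : X), WeakTendsto xs x → Qf x ≤ liminf (fun k => Qf (xs k)) atTop) ∧
  (∀ (xs : ℕ → X) (x : X), WeakTendsto xs x →
     Tendsto (fun k => Qf (xs k)) atTop (𝓝 (Qf x)) → Tendsto xs atTop (𝓝 x))

/-- (A1) for a two-parametric base mapping. -/
def A1two (f : X → P → X) (xb : X) (pb : P) : Prop :=
  ∃ L > (0:ℝ), ∃ ε > (0:ℝ), ∀ x₁ x₂ p₁ p₂,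
    ‖x₁ - xb‖ < ε → ‖x₂ - xb‖ < ε → dist p₁ pb < ε → dist p₂ pb < ε →
    ‖f x₁ p₁ - f x₂ p₂‖ ≤ L * (‖x₁ - x₂‖ + dist p₁ p₂)

/-- (A4) for a two-parametric base mapping. -/
def A4two (f : X → P → X) (Df : X → P → X →L[ℝ] X) (xb : X) (pb : P) : Prop :=
  (∃ η > (0:ℝ), ∀ ε > (0:ℝ), ∃ δ > (0:ℝ), ∀ x p,
      ‖x - xb‖ < η → dist p pb < η →
      ∀ x', ‖x' - x‖ < δ → ‖f x' p - f x p - Df x p (x' - x)‖ ≤ ε * ‖x' - x‖) ∧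
  Tendsto (fun t : X × P => Df t.1 t.2) (𝓝 (xb, pb)) (𝓝 (Df xb pb))

/-- Euclidean distance in X × ℝ. -/
def pairDist (a b : X × ℝ) : ℝ := Real.sqrt (‖a.1 - b.1‖ ^ 2 + |a.2 - b.2| ^ 2)

/-- Pompeiu–Hausdorff distance between subsets of X × ℝ (Euclidean product norm). -/
def hausPH (C₁ C₂ : Set (X × ℝ)) : ℝ :=
  sInf {η : ℝ | 0 ≤ η ∧ (∀ a ∈ C₁, ∃ b ∈ C₂, pairDist a b ≤ η) ∧
                 ∀ b ∈ C₂, ∃ a ∈ C₁, pairDist a b ≤ η}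

/-- Nonparametric prox-regularity with parameter r. -/
def ProxRegWithNP (g : X → EReal) (xb vh : X) (r : ℝ) : Prop :=
  ∃ ε > (0:ℝ), ∀ x u v, ‖x - xb‖ < ε → ‖u - xb‖ < ε → ‖v - vh‖ < ε →
    v ∈ limSubdiff g u → g u ≤ g xb + (ε : EReal) →
    g u + ((⟪v, x - u⟫ - r / 2 * ‖x - u‖ ^ 2 : ℝ) : EReal) ≤ g x

/-- Nonparametric subdifferential continuity. -/
def SubdiffContNP (g : X → EReal) (xb vh : X) : Prop :=
  Tendsto (fun t : X × X => g t.1) (𝓝[gph (limSubdiff g)] (xb, vh)) (𝓝 (g xb))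

/-- Nonparametric threshold of prox-regularity. -/
def proxThresholdNP (g : X → EReal) (xb vh : X) : ℝ :=
  sInf {r : ℝ | 0 < r ∧ ProxRegWithNP g xb vh r}

lemma coe_add_le_iff_toReal {a b : EReal} (ha : a ≠ ⊤) (ha' : a ≠ ⊥) (hb : b ≠ ⊤) (hb' : b ≠ ⊥)
    (c : ℝ) : a + (c : EReal) ≤ b ↔ a.toReal + c ≤ b.toReal := by
  lift a to ℝ using ⟨ha, ha'⟩
  lift b to ℝ using ⟨hb, hb'⟩
  simp only [EReal.toReal_coe]
  norm_cast

lemma regSubdiff_subset_limSubdiff (h : X → EReal) (x : X) :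
    regSubdiff h x ⊆ limSubdiff h x := fun v hv =>
  ⟨fun _ => x, fun _ => v, tendsto_const_nhds, tendsto_const_nhds, fun _ => hv,
    fun _ => tendsto_const_nhds⟩

/-- A local minimizer of `g + r ‖· - y‖²` yields the subgradient `2 r (y - x)`. -/
lemma mem_regSubdiff_of_isLocalMin_add_sq {g : X → EReal} (hg : ∀ x, g x ≠ ⊥) {x y : X} {r : ℝ}
    (hr : 0 < r) (hx : g x ≠ ⊤)
    (hmin : ∀ᶠ u in 𝓝 x, g x + ((r * ‖x - y‖ ^ 2 : ℝ) : EReal)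
      ≤ g u + ((r * ‖u - y‖ ^ 2 : ℝ) : EReal)) :
    (2 * r) • (y - x) ∈ regSubdiff g x := by
  refine ⟨hx, hg x, fun ε hε => ?_⟩
  filter_upwards [hmin, Metric.ball_mem_nhds x (div_pos hε hr)] with u hu hu'
  by_cases hut : g u = ⊤
  · rw [hut]; exact le_top
  rw [coe_add_le_iff_toReal hx (hg x) hut (hg u)]
  have h1 : (g x).toReal + r * ‖x - y‖ ^ 2 ≤ (g u).toReal + r * ‖u - y‖ ^ 2 := by
    have hx' := hg x
    have hu'' := hg u
    revert hu
    generalize g x = a at *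
    generalize g u = b at *
    lift a to ℝ using ⟨hx, hx'⟩
    lift b to ℝ using ⟨hut, hu''⟩
    intro hu
    exact_mod_cast hu
  have h2 : ‖u - y‖ ^ 2 = ‖u - x‖ ^ 2 - 2 * ⟪y - x, u - x⟫ + ‖x - y‖ ^ 2 := by
    have : u - y = (u - x) - (y - x) := by abel
    rw [this, norm_sub_sq_real, real_inner_comm, norm_sub_rev x y]
  have h3 : ‖u - x‖ < ε / r := by simpa [dist_eq_norm] using hu'
  have h4 : r * ‖u - x‖ ^ 2 ≤ ε * ‖u - x‖ := by
    rw [lt_div_iff₀ hr] at h3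
    nlinarith [norm_nonneg (u - x)]
  rw [real_inner_smul_left]
  rw [h2] at h1
  linarith

/-- A prox-regular subgradient exists only at points of finite value. -/
lemma ProxRegWithNP.ne_top {g : X → EReal} {xb vh : X} {r : ℝ}
    (hpr : ProxRegWithNP g xb vh r) (hvh : vh ∈ limSubdiff g xb) : g xb ≠ ⊤ := by
  intro htop
  obtain ⟨ε, hε, h⟩ := hpr
  obtain ⟨xs, vs, hxs, -, hvs, -⟩ := hvh.out
  obtain ⟨k, hk⟩ := (hxs.eventually (Metric.ball_mem_nhds xb hε)).exists
  have := h (xs k) xb vh (by simpa [dist_eq_norm] using hk) (by simpa) (by simpa) hvh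
    (by simp [htop])
  rw [htop, EReal.top_add_coe, top_le_iff] at this
  exact (hvs k).1 this

lemma ProxRegWithNP.mono {g : X → EReal} {xb vh : X} {r r' : ℝ}
    (hpr : ProxRegWithNP g xb vh r) (h : r ≤ r') : ProxRegWithNP g xb vh r' := by
  obtain ⟨ε, hε, H⟩ := hpr
  refine ⟨ε, hε, fun x u v hx hu hv hvu hgu => le_trans ?_ (H x u v hx hu hv hvu hgu)⟩
  gcongr

/-- `P` is a localization around `xb + vh / (2 r)` of the proximal mapping of `g` with
parameter `1 / (2 r)`; it parametrizes the graph of the subdifferential around `(xb, vh)`. -/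
structure IsProxLocalization (g : X → EReal) (xb vh : X) (r : ℝ) (P : X → X) (R ρ δ : ℝ) :
    Prop where
  r_pos : 0 < r
  R_pos : 0 < R
  ρ_pos : 0 < ρ
  δ_pos : 0 < δ
  ne_top : ∀ y ∈ ball (xb + (2 * r)⁻¹ • vh) ρ, g (P y) ≠ ⊤
  mem_ball : ∀ y ∈ ball (xb + (2 * r)⁻¹ • vh) ρ, P y ∈ ball xb R
  mem_limSubdiff : ∀ y ∈ ball (xb + (2 * r)⁻¹ • vh) ρ, (2 * r) • (y - P y) ∈ limSubdiff g (P y)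
  le : ∀ y ∈ ball (xb + (2 * r)⁻¹ • vh) ρ, ∀ x ∈ ball xb R, g x ≠ ⊤ →
    (g (P y)).toReal + 2 * r * ⟪y - P y, x - P y⟫ - r / 2 * ‖x - P y‖ ^ 2 ≤ (g x).toReal
  param : ∀ u v, ‖u - xb‖ < δ → ‖v - vh‖ < δ → v ∈ limSubdiff g u →
    u + (2 * r)⁻¹ • v ∈ ball (xb + (2 * r)⁻¹ • vh) ρ ∧ P (u + (2 * r)⁻¹ • v) = u

/-- Completing the square in the prox-regularity inequality. -/
lemma inner_sub_expand (r : ℝ) (x u y v : X) (hv : v = (2 * r) • (y - u)) :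
    ⟪v, x - u⟫ - r / 2 * ‖x - u‖ ^ 2 + r * ‖x - y‖ ^ 2
      = r * ‖u - y‖ ^ 2 + r / 2 * ‖x - u‖ ^ 2 := by
  have : x - y = (x - u) - (y - u) := by abel
  rw [hv, this, norm_sub_sq_real (x - u) (y - u), real_inner_smul_left, norm_sub_rev u y,
    real_inner_comm (x - u) (y - u)]
  ring

lemma exists_isProxLocalization [FiniteDimensional ℝ X] {g : X → EReal} {xb vh : X} {r : ℝ}
    (hg_lsc : LowerSemicontinuous g) (hg : ∀ x, g x ≠ ⊥) (hvh : vh ∈ limSubdiff g xb)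
    (hr : 0 < r) (hpr : ProxRegWithNP g xb vh r) (hsc : SubdiffContNP g xb vh) :
    ∃ P R ρ δ, IsProxLocalization g xb vh r P R ρ δ := by
  have hfin := hpr.ne_top hvh
  obtain ⟨ε, hε, H⟩ := hpr
  -- values of `g` along the graph
  obtain ⟨η, hη, hηε, hval⟩ : ∃ η > 0, η ≤ ε ∧ ∀ u v, ‖u - xb‖ < η → ‖v - vh‖ < η →
      v ∈ limSubdiff g u → g u < g xb + (ε : EReal) := by
    have hlt : g xb < g xb + (ε : EReal) := by
      have := hg xb
      generalize g xb = a at *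
      lift a to ℝ using ⟨hfin, this⟩
      exact_mod_cast (lt_add_of_pos_right a hε)
    have h1 := (tendsto_order.1 hsc).2 _ hlt
    rw [eventually_nhdsWithin_iff, Metric.eventually_nhds_iff] at h1
    obtain ⟨η, hη, h1⟩ := h1
    refine ⟨min η ε, lt_min hη hε, min_le_right _ _, fun u v hu hv huv => ?_⟩
    refine h1 (y := (u, v)) ?_ huv
    rw [Prod.dist_eq, dist_eq_norm, dist_eq_norm]
    exact max_lt (hu.trans_le (min_le_left _ _)) (hv.trans_le (min_le_left _ _))
  -- prox-regularity in real form
  have Hreal : ∀ x u v, ‖x - xb‖ < ε → ‖u - xb‖ < η → ‖v - vh‖ < η → v ∈ limSubdiff g u →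
      g x ≠ ⊤ → g u ≠ ⊤ ∧ (g u).toReal + (⟪v, x - u⟫ - r / 2 * ‖x - u‖ ^ 2) ≤ (g x).toReal := by
    intro x u v hx hu hv huv hgx
    have h1 := hval u v hu hv huv
    have hut : g u ≠ ⊤ := h1.ne_top
    refine ⟨hut, ?_⟩
    rw [← coe_add_le_iff_toReal hut (hg u) hgx (hg x)]
    exact H x u v hx (hu.trans_le hηε) (hv.trans_le hηε) huv h1.le
  set yb : X := xb + (2 * r)⁻¹ • vh with hyb
  have hvb : vh = (2 * r) • (yb - xb) := by
    rw [hyb, add_sub_cancel_left, smul_smul, mul_inv_cancel₀ (by positivity), one_smul]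
  set R := η / 2 with hR
  -- existence of proximal points
  have hex : ∀ y, ∃ x ∈ closedBall xb R, ∀ u ∈ closedBall xb R,
      g x + ((r * ‖x - y‖ ^ 2 : ℝ) : EReal) ≤ g u + ((r * ‖u - y‖ ^ 2 : ℝ) : EReal) := by
    intro y
    have hl : LowerSemicontinuous (fun x => g x + ((r * ‖x - y‖ ^ 2 : ℝ) : EReal)) := by
      refine LowerSemicontinuous.add' hg_lsc ?_ ?_
      · refine Continuous.lowerSemicontinuous ?_
        exact continuous_coe_real_ereal.comp (by fun_prop)
      · intro x
        exact EReal.continuousAt_add (Or.inr (EReal.coe_ne_bot _)) (Or.inr (EReal.coe_ne_top _))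
    obtain ⟨x, hx, hmin⟩ := (hl.lowerSemicontinuousOn (closedBall xb R)).exists_isMinOn
      ⟨xb, mem_closedBall_self (by positivity)⟩ (isCompact_closedBall xb R)
    exact ⟨x, hx, fun u hu => hmin hu⟩
  choose P hPmem hPmin using hex
  have hPfin : ∀ y, g (P y) ≠ ⊤ := by
    intro y h
    have := hPmin y xb (mem_closedBall_self (by positivity))
    rw [h, EReal.top_add_coe, top_le_iff] at this
    exact EReal.add_ne_top hfin (EReal.coe_ne_top _) this
  have hPreal : ∀ y, ∀ u ∈ closedBall xb R, g u ≠ ⊤ →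
      (g (P y)).toReal + r * ‖P y - y‖ ^ 2 ≤ (g u).toReal + r * ‖u - y‖ ^ 2 := by
    intro y u hu hut
    have h1 := hPmin y u hu
    have h2 := hPfin y
    have h3 := hg (P y)
    have h4 := hg u
    generalize g (P y) = a at *
    generalize g u = b at *
    lift a to ℝ using ⟨h2, h3⟩
    lift b to ℝ using ⟨hut, h4⟩
    exact_mod_cast h1
  have hclose : ∀ y, ‖P y - xb‖ ≤ 4 * ‖y - yb‖ := by
    intro y
    have h1 := hPreal y xb (mem_closedBall_self (by positivity)) hfin
    have h0 : ‖P y - xb‖ ≤ η / 2 := by simpa [dist_eq_norm] using hPmem y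
    have h2 := (Hreal (P y) xb vh (by linarith) (by simpa) (by simpa) hvh (hPfin y)).2
    have h3 := inner_sub_expand r (P y) xb yb vh hvb
    have e1 : ‖P y - y‖ ^ 2 = ‖P y - yb‖ ^ 2 - 2 * ⟪P y - yb, y - yb⟫ + ‖y - yb‖ ^ 2 := by
      rw [← norm_sub_sq_real]; congr 2; abel
    have e2 : ‖xb - y‖ ^ 2 = ‖xb - yb‖ ^ 2 - 2 * ⟪xb - yb, y - yb⟫ + ‖y - yb‖ ^ 2 := by
      rw [← norm_sub_sq_real]; congr 2; abel
    have e3 : ⟪P y - yb, y - yb⟫ - ⟪xb - yb, y - yb⟫ = ⟪P y - xb, y - yb⟫ := by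
      rw [← inner_sub_left]; congr 1; abel
    have e4 := real_inner_le_norm (P y - xb) (y - yb)
    rw [e1, e2] at h1
    have h5 : r / 2 * ‖P y - xb‖ ^ 2 ≤ 2 * r * (‖P y - xb‖ * ‖y - yb‖) := by
      have : r / 2 * ‖P y - xb‖ ^ 2 ≤ 2 * r * ⟪P y - xb, y - yb⟫ := by
        rw [← e3]; linarith
      exact this.trans (by gcongr)
    by_contra! hcon
    have : 0 < ‖P y - xb‖ := lt_of_le_of_lt (by positivity) hcon
    nlinarith [mul_pos hr this]
  set ρ := min (η / 16) (η / (16 * r)) with hρ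
  have hρpos : 0 < ρ := by positivity
  have hPball : ∀ y ∈ ball yb ρ, ‖P y - xb‖ < R := by
    intro y hy
    have h1 := hclose y
    have h2 : ‖y - yb‖ < ρ := by simpa [dist_eq_norm] using hy
    have h3 : ρ ≤ η / 16 := min_le_left _ _
    rw [hR]; linarith
  have hvball : ∀ y ∈ ball yb ρ, ‖(2 * r) • (y - P y) - vh‖ < η := by
    intro y hy
    have h1 := hclose y
    have h2 : ‖y - yb‖ < ρ := by simpa [dist_eq_norm] using hy
    have h3 : ρ ≤ η / (16 * r) := min_le_right _ _
    rw [hvb, ← smul_sub, norm_smul, Real.norm_of_nonneg (by positivity)]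
    have h4 : ‖y - P y - (yb - xb)‖ ≤ ‖y - yb‖ + ‖P y - xb‖ := by
      have : y - P y - (yb - xb) = (y - yb) - (P y - xb) := by abel
      rw [this]; exact norm_sub_le _ _
    have h5 : ‖y - P y - (yb - xb)‖ ≤ 5 * (η / (16 * r)) := by linarith
    calc _ ≤ 2 * r * (5 * (η / (16 * r))) := by gcongr
      _ = 10 / 16 * η := by field_simp; ring
      _ < η := by linarith
  have hPsub : ∀ y ∈ ball yb ρ, (2 * r) • (y - P y) ∈ limSubdiff g (P y) := by
    intro y hy
    refine regSubdiff_subset_limSubdiff g _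
      (mem_regSubdiff_of_isLocalMin_add_sq hg hr (hPfin y) ?_)
    have : ball xb R ∈ 𝓝 (P y) :=
      isOpen_ball.mem_nhds (by simpa [dist_eq_norm] using hPball y hy)
    filter_upwards [this] with u hu
    exact hPmin y u (ball_subset_closedBall hu)
  refine ⟨P, R, ρ, min R (min (ρ / 2) (r * ρ)), hr, by positivity, hρpos, by positivity,
    fun y _ => hPfin y, fun y hy => by simpa [dist_eq_norm] using hPball y hy, hPsub, ?_, ?_⟩
  · intro y hy x hx hxt
    have hx' : ‖x - xb‖ < R := by simpa [dist_eq_norm] using hx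
    have := (Hreal x (P y) _ (by linarith) (by linarith [hPball y hy]) (hvball y hy)
      (hPsub y hy) hxt).2
    rw [real_inner_smul_left] at this
    linarith
  · intro u v hu hv huv
    have hu1 : ‖u - xb‖ < R := hu.trans_le (min_le_left _ _)
    have hu2 : ‖u - xb‖ < ρ / 2 := hu.trans_le ((min_le_right _ _).trans (min_le_left _ _))
    have hv2 : ‖v - vh‖ < r * ρ := hv.trans_le ((min_le_right _ _).trans (min_le_right _ _))
    have hv1 : ‖v - vh‖ < η := by
      have : ρ ≤ η / (16 * r) := min_le_right _ _
      calc _ < r * ρ := hv2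
        _ ≤ r * (η / (16 * r)) := by gcongr
        _ = η / 16 := by field_simp
        _ ≤ η := by linarith
    set y := u + (2 * r)⁻¹ • v with hy
    have hvy : v = (2 * r) • (y - u) := by
      rw [hy, add_sub_cancel_left, smul_smul, mul_inv_cancel₀ (by positivity), one_smul]
    refine ⟨?_, ?_⟩
    · rw [mem_ball, dist_eq_norm]
      have : y - yb = (u - xb) + (2 * r)⁻¹ • (v - vh) := by rw [hy, hyb, smul_sub]; abel
      rw [this]
      refine (norm_add_le _ _).trans_lt ?_
      rw [norm_smul, Real.norm_of_nonneg (by positivity)]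
      have : (2 * r)⁻¹ * ‖v - vh‖ < (2 * r)⁻¹ * (r * ρ) := by gcongr
      have e : (2 * r)⁻¹ * (r * ρ) = ρ / 2 := by field_simp
      linarith
    · have hPy : ‖P y - xb‖ ≤ η / 2 := by simpa [dist_eq_norm] using hPmem y
      obtain ⟨hut, h1⟩ := Hreal (P y) u v (by linarith) (by linarith) hv1 huv (hPfin y)
      have h2 := hPreal y u (by simpa [dist_eq_norm] using hu1.le) hut
      have h3 := inner_sub_expand r (P y) u y v hvy
      have h4 : r / 2 * ‖P y - u‖ ^ 2 ≤ 0 := by linarith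
      have h5 : ‖P y - u‖ ^ 2 ≤ 0 := by
        by_contra! h
        exact absurd h4 (not_le.2 (by positivity))
      have h6 : ‖P y - u‖ = 0 := by nlinarith [norm_nonneg (P y - u)]
      exact sub_eq_zero.1 (norm_eq_zero.1 h6)

/-- A nonsmooth mean value inequality for a Lipschitz map along a segment. -/
lemma exists_subgradient_of_lt_inner [FiniteDimensional ℝ X] {P : X → X} {c : X} {ρ L M : ℝ}
    (hL : 0 ≤ L) (hP : ∀ y ∈ ball c ρ, ∀ y' ∈ ball c ρ, ‖P y - P y'‖ ≤ L * ‖y - y'‖)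
    {y₀ y₁ : X} (h₀ : y₀ ∈ ball c (ρ / 2)) (h₁ : y₁ ∈ ball c (ρ / 2))
    (hlt : M * ‖y₁ - y₀‖ ^ 2 < ⟪P y₁ - P y₀, y₁ - y₀⟫) :
    ∃ y ∈ ball c ρ, ∃ s : X, ‖s‖ ≤ 2 * L * ‖y₁ - y₀‖ ∧ M * ‖y₁ - y₀‖ ^ 2 ≤ ⟪s, y₁ - y₀⟫ ∧
      ∀ ε > 0, ∀ᶠ y' in 𝓝 y,
        ⟪s, y' - y⟫ - ε * ‖y' - y‖ ≤ ⟪P y' - P y, y₁ - y₀⟫ := by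
  have hρ : 0 < ρ := by linarith [dist_nonneg.trans_lt (mem_ball.1 h₀)]
  set d := y₁ - y₀ with hd
  set gap := ⟪P y₁ - P y₀, d⟫ - M * ‖d‖ ^ 2 with hgap
  have hgap0 : 0 < gap := by rw [hgap]; linarith
  obtain ⟨k, hk0, hk1, hk2⟩ : ∃ k : ℝ, 0 < k ∧ L * ‖d‖ < k * (ρ / 8) ∧
      (L * ‖d‖) ^ 2 < 4 * k * gap := by
    refine ⟨L * ‖d‖ / (ρ / 8) + (L * ‖d‖) ^ 2 / (4 * gap) + 1, by positivity, ?_, ?_⟩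
    · have e : L * ‖d‖ / (ρ / 8) * (ρ / 8) = L * ‖d‖ := by field_simp
      have : 0 ≤ (L * ‖d‖) ^ 2 / (4 * gap) * (ρ / 8) := by positivity
      nlinarith
    · have e : (L * ‖d‖) ^ 2 / (4 * gap) * (4 * gap) = (L * ‖d‖) ^ 2 := by field_simp
      have : 0 ≤ L * ‖d‖ / (ρ / 8) * (4 * gap) := by positivity
      nlinarith
  set F : X × ℝ → ℝ := fun q =>
    ⟪P q.1, d⟫ - M * q.2 * ‖d‖ ^ 2 + k * ‖q.1 - (y₀ + q.2 • d)‖ ^ 2 with hF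
  set K := closedBall c (3 * ρ / 4) with hK
  have hKb : K ⊆ ball c ρ := closedBall_subset_ball (by linarith)
  have hPc : ContinuousOn P (ball c ρ) := by
    refine LipschitzOnWith.continuousOn (K := ⟨L, hL⟩) ?_
    refine LipschitzOnWith.of_dist_le_mul fun y hy y' hy' => ?_
    rw [dist_eq_norm, dist_eq_norm]
    exact hP y hy y' hy'
  have hFc : ContinuousOn F (K ×ˢ Icc (0:ℝ) 1) := by
    have h1 : ContinuousOn (fun q : X × ℝ => P q.1) (K ×ˢ Icc (0:ℝ) 1) :=
      (hPc.mono hKb).comp continuousOn_fst fun q hq => hq.1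
    have h2 : ContinuousOn (fun q : X × ℝ => ⟪P q.1, d⟫) (K ×ˢ Icc (0:ℝ) 1) :=
      h1.inner continuousOn_const
    refine (h2.sub ?_).add ?_
    · exact Continuous.continuousOn (by fun_prop)
    · exact Continuous.continuousOn (by fun_prop)
  have hsub : ball c (ρ / 2) ⊆ K :=
    ball_subset_closedBall.trans (closedBall_subset_closedBall (by linarith))
  obtain ⟨⟨y, t⟩, ⟨hy, ht⟩, hmin⟩ :=
    ((isCompact_closedBall c (3 * ρ / 4)).prod isCompact_Icc).exists_isMinOn
      ⟨(y₀, (0:ℝ)), hsub h₀, by simp⟩ hFc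
  replace hmin : ∀ y' ∈ K, ∀ t' ∈ Icc (0:ℝ) 1, F (y, t) ≤ F (y', t') :=
    fun y' hy' t' ht' => hmin (a := (y', t')) ⟨hy', ht'⟩
  simp only [hF] at hmin
  simp only at hy ht
  set p := y₀ + t • d with hp
  have hpb : p ∈ ball c (ρ / 2) := by
    refine (convex_ball c (ρ / 2)).segment_subset h₀ h₁ ?_
    rw [segment_eq_image']
    exact ⟨t, ht, rfl⟩
  set e := y - p with he
  have hek : k * ‖e‖ ≤ L * ‖d‖ := by
    have h1 := hmin p (hsub hpb) t ht
    rw [← hp, sub_self, norm_zero] at h1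
    have h2 : k * ‖e‖ ^ 2 ≤ ⟪P p - P y, d⟫ := by rw [inner_sub_left]; linarith
    have h3 := real_inner_le_norm (P p - P y) d
    have h4 := hP p (hKb (hsub hpb)) y (hKb hy)
    rw [norm_sub_rev p y, ← he] at h4
    have h5 : k * ‖e‖ ^ 2 ≤ L * ‖e‖ * ‖d‖ := h2.trans (h3.trans (by gcongr))
    by_contra! hcon
    have : 0 < ‖e‖ := by
      by_contra! h
      have : ‖e‖ = 0 := le_antisymm h (norm_nonneg _)
      rw [this, mul_zero] at hcon
      exact absurd hcon (not_lt.2 (by positivity))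
    nlinarith
  have hyint : y ∈ ball c (3 * ρ / 4) := by
    have h1 : ‖e‖ < ρ / 8 := by
      have : k * ‖e‖ < k * (ρ / 8) := hek.trans_lt hk1
      exact lt_of_mul_lt_mul_left this hk0.le
    rw [mem_ball]
    have h2 : dist y p < ρ / 8 := by rwa [dist_eq_norm]
    have h3 := mem_ball.1 hpb
    linarith [dist_triangle y p c]
  have ht1 : t < 1 := by
    refine lt_of_le_of_ne ht.2 fun h1 => ?_
    have hpy : p = y₁ := by rw [hp, h1, one_smul, hd]; abel
    have h2 := hmin y₀ (hsub h₀) 0 (by simp)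
    rw [h1] at h2
    simp only [zero_smul, add_zero, sub_self, norm_zero] at h2
    have h3 := hP y₁ (hKb (hsub h₁)) y (hKb hy)
    rw [norm_sub_rev y₁ y, ← hpy, ← he] at h3
    have h4 := real_inner_le_norm (P y₁ - P y) d
    rw [hpy] at h3
    have h5 : ⟪P y₁ - P y, d⟫ ≤ L * ‖e‖ * ‖d‖ := h4.trans (by gcongr)
    have h6 : ⟪P y₁ - P y, d⟫ = gap + M * ‖d‖ ^ 2 + ⟪P y₀, d⟫ - ⟪P y, d⟫ := by
      rw [hgap, inner_sub_left, inner_sub_left]; ring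
    have h7 : gap + k * ‖e‖ ^ 2 ≤ L * ‖d‖ * ‖e‖ := by nlinarith
    nlinarith [sq_nonneg (2 * k * ‖e‖ - L * ‖d‖)]
  refine ⟨y, hKb hy, (-(2 * k)) • e, ?_, ?_, ?_⟩
  · rw [norm_smul, norm_neg, Real.norm_of_nonneg (by positivity)]; linarith
  · rw [real_inner_smul_left]
    have key : ∀ h ∈ Ioo 0 (1 - t), M * ‖d‖ ^ 2 + 2 * k * ⟪e, d⟫ ≤ h * (k * ‖d‖ ^ 2) := by
      intro h hh
      have h1 := hmin y hy (t + h) ⟨by linarith [ht.1, hh.1], by linarith [hh.2]⟩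
      have h2 : y - (y₀ + (t + h) • d) = e - h • d := by rw [he, hp, add_smul]; abel
      rw [h2, norm_sub_sq_real e (h • d), real_inner_smul_right, norm_smul,
        Real.norm_of_nonneg hh.1.le] at h1
      have h3 : h * (M * ‖d‖ ^ 2 + 2 * k * ⟪e, d⟫) ≤ h * (h * (k * ‖d‖ ^ 2)) := by nlinarith
      exact le_of_mul_le_mul_left h3 hh.1
    have hlim : Tendsto (fun h : ℝ => h * (k * ‖d‖ ^ 2)) (𝓝[>] 0) (𝓝 (0 * (k * ‖d‖ ^ 2))) :=
      (Continuous.tendsto (by fun_prop) 0).mono_left nhdsWithin_le_nhds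
    have := ge_of_tendsto hlim (by
      filter_upwards [Ioo_mem_nhdsGT (sub_pos.2 ht1)] with h hh using key h hh)
    linarith
  · intro ε hε
    filter_upwards [isOpen_ball.mem_nhds hyint, Metric.ball_mem_nhds y (div_pos hε hk0)]
      with y' hy' hy''
    have h1 := hmin y' (ball_subset_closedBall hy') t ht
    have h2 : y' - p = (y' - y) + e := by rw [he]; abel
    rw [← hp, h2, norm_add_sq_real] at h1
    rw [real_inner_smul_left, inner_sub_left (P y') (P y), real_inner_comm (y' - y) e]
    have h3 : ‖y' - y‖ < ε / k := by simpa [dist_eq_norm] using hy''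
    rw [lt_div_iff₀ hk0] at h3
    have h4 : k * ‖y' - y‖ ^ 2 ≤ ε * ‖y' - y‖ := by nlinarith [norm_nonneg (y' - y)]
    nlinarith

namespace IsProxLocalization

variable {g : X → EReal} {xb vh : X} {r R ρ δ : ℝ} {P : X → X}

lemma le_inner (h : IsProxLocalization g xb vh r P R ρ δ) {y y' : X}
    (hy : y ∈ ball (xb + (2 * r)⁻¹ • vh) ρ) (hy' : y' ∈ ball (xb + (2 * r)⁻¹ • vh) ρ) :
    ‖P y - P y'‖ ^ 2 ≤ 2 * ⟪y - y', P y - P y'⟫ := by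
  have h1 := h.le y hy (P y') (h.mem_ball y' hy') (h.ne_top y' hy')
  have h2 := h.le y' hy' (P y) (h.mem_ball y hy) (h.ne_top y hy)
  have e1 : P y' - P y = -(P y - P y') := by abel
  rw [e1, norm_neg, inner_neg_right] at h1
  have e2 : ⟪y - y', P y - P y'⟫ - ‖P y - P y'‖ ^ 2
      = ⟪y - P y, P y - P y'⟫ - ⟪y' - P y', P y - P y'⟫ := by
    rw [← real_inner_self_eq_norm_sq, ← inner_sub_left, ← inner_sub_left]
    congr 1; abel
  have h3 : r * ‖P y - P y'‖ ^ 2 ≤ r * (2 * ⟪y - y', P y - P y'⟫) := by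
    have : r * (⟪y - y', P y - P y'⟫ - ‖P y - P y'‖ ^ 2)
      = r * ⟪y - P y, P y - P y'⟫ - r * ⟪y' - P y', P y - P y'⟫ := by rw [e2]; ring
    nlinarith
  exact le_of_mul_le_mul_left h3 h.r_pos

/-- The reflected map `P - id` is nonexpansive. -/
lemma norm_sub_sub_le (h : IsProxLocalization g xb vh r P R ρ δ) {y y' : X}
    (hy : y ∈ ball (xb + (2 * r)⁻¹ • vh) ρ) (hy' : y' ∈ ball (xb + (2 * r)⁻¹ • vh) ρ) :
    ‖(P y - P y') - (y - y')‖ ≤ ‖y - y'‖ := by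
  have h1 := h.le_inner hy hy'
  rw [real_inner_comm] at h1
  have h2 := norm_sub_sq_real (P y - P y') (y - y')
  exact (sq_le_sq₀ (norm_nonneg _) (norm_nonneg _)).1 (by linarith)

lemma norm_sub_le (h : IsProxLocalization g xb vh r P R ρ δ) {y y' : X}
    (hy : y ∈ ball (xb + (2 * r)⁻¹ • vh) ρ) (hy' : y' ∈ ball (xb + (2 * r)⁻¹ • vh) ρ) :
    ‖P y - P y'‖ ≤ 2 * ‖y - y'‖ := by
  have h1 := h.norm_sub_sub_le hy hy'
  have h2 := norm_le_norm_add_norm_sub' (P y - P y') (y - y')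
  linarith

lemma continuousAt (h : IsProxLocalization g xb vh r P R ρ δ) {y : X}
    (hy : y ∈ ball (xb + (2 * r)⁻¹ • vh) ρ) : ContinuousAt P y := by
  have h1 : LipschitzOnWith 2 P (ball (xb + (2 * r)⁻¹ • vh) ρ) := by
    refine LipschitzOnWith.of_dist_le_mul fun y hy y' hy' => ?_
    rw [dist_eq_norm, dist_eq_norm]
    exact h.norm_sub_le hy hy'
  exact h1.continuousOn.continuousAt (isOpen_ball.mem_nhds hy)

lemma apply_base (h : IsProxLocalization g xb vh r P R ρ δ) (hvh : vh ∈ limSubdiff g xb) :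
    P (xb + (2 * r)⁻¹ • vh) = xb :=
  (h.param xb vh (by simpa using h.δ_pos) (by simpa using h.δ_pos) hvh).2

/-- Regular coderivatives near the reference point are bounded below by `-r`. -/
lemma neg_le_inner_of_mem_regNC2 (h : IsProxLocalization g xb vh r P R ρ δ) {u v z w : X}
    (hu : ‖u - xb‖ < δ) (hv : ‖v - vh‖ < δ) (huv : v ∈ limSubdiff g u)
    (hzw : (z, -w) ∈ regNC2 (gph (limSubdiff g)) (u, v)) :
    -r * ‖w‖ ^ 2 ≤ ⟪z, w⟫ := by
  have hr := h.r_pos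
  obtain ⟨hyb, hPy⟩ := h.param u v hu hv huv
  set y := u + (2 * r)⁻¹ • v with hy
  have hvy : v = (2 * r) • (y - u) := by
    rw [hy, add_sub_cancel_left, smul_smul, mul_inv_cancel₀ (by positivity), one_smul]
  set a := z + (2 * r) • w with ha
  -- test with the curve `t ↦ y + t d`, where `d = z`
  have key : ∀ ε > 0, ‖z‖ ^ 2 ≤ ‖a‖ * ‖z‖ + ε * ((2 + 2 * r) * ‖z‖) := by
    intro ε hε
    have h1 := hzw ε hε
    have hcy : Tendsto (fun t : ℝ => y + t • z) (𝓝 0) (𝓝 y) := by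
      have : Continuous fun t : ℝ => y + t • z := by fun_prop
      simpa using this.tendsto 0
    have hcP : Tendsto (fun t : ℝ => P (y + t • z)) (𝓝 0) (𝓝 u) := by
      have := (h.continuousAt hyb).tendsto.comp hcy
      rwa [hPy] at this
    have hcv : Tendsto (fun t : ℝ => (2 * r) • (y + t • z - P (y + t • z))) (𝓝 0) (𝓝 v) := by
      rw [hvy]
      exact (hcy.sub hcP).const_smul _
    have hball : ∀ᶠ t : ℝ in 𝓝 0, y + t • z ∈ ball (xb + (2 * r)⁻¹ • vh) ρ :=
      hcy.eventually (isOpen_ball.mem_nhds hyb)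
    have hcw : Tendsto (fun t : ℝ => (P (y + t • z), (2 * r) • (y + t • z - P (y + t • z))))
        (𝓝 0) (𝓝[gph (limSubdiff g)] (u, v)) := by
      refine tendsto_nhdsWithin_iff.2 ⟨hcP.prodMk_nhds hcv, ?_⟩
      filter_upwards [hball] with t ht using h.mem_limSubdiff _ ht
    have h2 : ∀ᶠ t : ℝ in 𝓝[>] 0, _ :=
      ((hcw.eventually h1).and hball).filter_mono nhdsWithin_le_nhds
    obtain ⟨t, ⟨h3, h4⟩, ht⟩ := (h2.and self_mem_nhdsWithin).exists
    replace ht : 0 < t := ht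
    simp only at h3
    set n := (P (y + t • z) - P y) - (y + t • z - y) with hn
    have hnle : ‖n‖ ≤ t * ‖z‖ := by
      have := h.norm_sub_sub_le h4 hyb
      rwa [← hn, add_sub_cancel_left, norm_smul, Real.norm_of_nonneg ht.le] at this
    have e1 : P (y + t • z) - u = n + t • z := by rw [hn, hPy]; abel
    have e2 : (2 * r) • (y + t • z - P (y + t • z)) - v = -((2 * r) • n) := by
      rw [hvy, hn, hPy, ← smul_sub, ← smul_neg]; congr 1; abel
    rw [e1, e2, inner_neg_neg, real_inner_smul_right, inner_add_right, real_inner_smul_right,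
      real_inner_self_eq_norm_sq, norm_neg, norm_smul, Real.norm_of_nonneg (by positivity)] at h3
    have e3 : ⟪a, n⟫ = ⟪z, n⟫ + 2 * r * ⟪w, n⟫ := by
      rw [ha, inner_add_left, real_inner_smul_left]
    have h5 : √(‖n + t • z‖ ^ 2 + (2 * r * ‖n‖) ^ 2) ≤ t * ((2 + 2 * r) * ‖z‖) := by
      have h6 : ‖n + t • z‖ ≤ 2 * (t * ‖z‖) := by
        refine (norm_add_le _ _).trans ?_
        rw [norm_smul, Real.norm_of_nonneg ht.le]; linarith
      have h7 : 2 * r * ‖n‖ ≤ 2 * r * (t * ‖z‖) := by gcongr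
      refine Real.sqrt_le_iff.2 ⟨by positivity, ?_⟩
      have h8 : ‖n + t • z‖ ^ 2 ≤ (2 * (t * ‖z‖)) ^ 2 := by gcongr
      have h9 : (2 * r * ‖n‖) ^ 2 ≤ (2 * r * (t * ‖z‖)) ^ 2 := by gcongr
      have : 0 ≤ r * (t * ‖z‖) ^ 2 := by positivity
      nlinarith
    have h6 : -(‖a‖ * (t * ‖z‖)) ≤ ⟪a, n⟫ := by
      have := (abs_le.1 (abs_real_inner_le_norm a n)).1
      have : ‖a‖ * ‖n‖ ≤ ‖a‖ * (t * ‖z‖) := by gcongr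
      linarith
    have h7 : ε * √(‖n + t • z‖ ^ 2 + (2 * r * ‖n‖) ^ 2) ≤ ε * (t * ((2 + 2 * r) * ‖z‖)) := by
      gcongr
    have h8 : t * ‖z‖ ^ 2 ≤ t * (‖a‖ * ‖z‖ + ε * ((2 + 2 * r) * ‖z‖)) := by linarith
    exact le_of_mul_le_mul_left h8 ht
  have hza : ‖z‖ ^ 2 ≤ ‖a‖ * ‖z‖ := by
    have hlim : Tendsto (fun ε : ℝ => ‖a‖ * ‖z‖ + ε * ((2 + 2 * r) * ‖z‖)) (𝓝[>] 0)
        (𝓝 (‖a‖ * ‖z‖ + 0 * ((2 + 2 * r) * ‖z‖))) :=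
      (Continuous.tendsto (by fun_prop) 0).mono_left nhdsWithin_le_nhds
    have := ge_of_tendsto hlim (by
      filter_upwards [self_mem_nhdsWithin] with ε hε using key ε hε)
    linarith
  have hza' : ‖z‖ ≤ ‖a‖ := by
    by_contra! hcon
    have : 0 < ‖z‖ := (norm_nonneg a).trans_lt hcon
    nlinarith
  have h1 : ‖z‖ ^ 2 ≤ ‖a‖ ^ 2 := by gcongr
  rw [ha, norm_add_sq_real, real_inner_smul_right, norm_smul, Real.norm_of_nonneg (by positivity)]
    at h1
  have h2 : (4 * r) * (-r * ‖w‖ ^ 2) ≤ (4 * r) * ⟪z, w⟫ := by nlinarith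
  exact le_of_mul_le_mul_left h2 (by positivity)

lemma neg_le_inner_of_mem_limCoderiv (h : IsProxLocalization g xb vh r P R ρ δ) {z w : X}
    (hzw : z ∈ limCoderiv (limSubdiff g) xb vh w) : -r * ‖w‖ ^ 2 ≤ ⟪z, w⟫ := by
  obtain ⟨ωs, ζs, hω, hωlim, hζ, hζlim⟩ := hzw.out
  have h1 : Tendsto (fun k => (ζs k).1) atTop (𝓝 z) := (continuous_fst.tendsto _).comp hζlim
  have h2 : Tendsto (fun k => -(ζs k).2) atTop (𝓝 w) := by
    have := ((continuous_snd.tendsto _).comp hζlim).neg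
    simpa using this
  have h3 : ∀ᶠ k in atTop, (ωs k).1 ∈ ball xb δ :=
    ((continuous_fst.tendsto _).comp hωlim).eventually (ball_mem_nhds _ h.δ_pos)
  have h4 : ∀ᶠ k in atTop, (ωs k).2 ∈ ball vh δ :=
    ((continuous_snd.tendsto _).comp hωlim).eventually (ball_mem_nhds _ h.δ_pos)
  refine le_of_tendsto_of_tendsto ((h2.norm.pow 2).const_mul (-r)) (h1.inner h2) ?_
  filter_upwards [h3, h4] with k hk hk'
  refine h.neg_le_inner_of_mem_regNC2 (by simpa [dist_eq_norm] using hk)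
    (by simpa [dist_eq_norm] using hk') (hω k) ?_
  simpa using hζ k

/-- Supergradients of `⟪a, P ·⟫` give regular normals to the graph of the subdifferential. -/
lemma mem_regNC2 (h : IsProxLocalization g xb vh r P R ρ δ) {y a s : X}
    (hyx : ‖P y - xb‖ < δ)
    (hyv : ‖(2 * r) • (y - P y) - vh‖ < δ)
    (hs : ∀ ε > 0, ∀ᶠ y' in 𝓝 y, ⟪a, P y' - P y⟫ ≤ ⟪s, y' - y⟫ + ε * ‖y' - y‖) :
    (a - s, -((2 * r)⁻¹ • s)) ∈ regNC2 (gph (limSubdiff g)) (P y, (2 * r) • (y - P y)) := by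
  have hr := h.r_pos
  intro ε hε
  set v := (2 * r) • (y - P y) with hv
  have hyP : P y + (2 * r)⁻¹ • v = y := by
    rw [hv, smul_smul, inv_mul_cancel₀ (by positivity), one_smul]; abel
  set C := 1 + (2 * r)⁻¹ with hC
  have hCpos : 0 < C := by positivity
  have h1 := hs (ε / C) (by positivity)
  have hc : Tendsto (fun ω : X × X => ω.1 + (2 * r)⁻¹ • ω.2) (𝓝 (P y, v)) (𝓝 y) := by
    have : Continuous fun ω : X × X => ω.1 + (2 * r)⁻¹ • ω.2 := by fun_prop
    have := this.tendsto (P y, v)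
    simp only at this
    rwa [hyP] at this
  have h2 : ∀ᶠ ω in 𝓝 (P y, v), ω.1 ∈ ball xb δ :=
    (continuous_fst.tendsto (P y, v)).eventually
      (isOpen_ball.mem_nhds (by simpa [dist_eq_norm] using hyx))
  have h3 : ∀ᶠ ω in 𝓝 (P y, v), ω.2 ∈ ball vh δ :=
    (continuous_snd.tendsto (P y, v)).eventually
      (isOpen_ball.mem_nhds (by simpa [dist_eq_norm] using hyv))
  rw [eventually_nhdsWithin_iff]
  filter_upwards [hc.eventually h1, h2, h3] with ω h4 h5 h6 hω
  obtain ⟨-, h7⟩ := h.param ω.1 ω.2 (by simpa [dist_eq_norm] using h5)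
    (by simpa [dist_eq_norm] using h6) hω
  rw [h7] at h4
  set dx := ω.1 - P y with hdx
  set dv := ω.2 - v with hdv
  have e1 : ω.1 + (2 * r)⁻¹ • ω.2 - y = dx + (2 * r)⁻¹ • dv := by
    nth_rw 1 [← hyP]; rw [hdx, hdv, smul_sub]; abel
  rw [e1, inner_add_right, real_inner_smul_right] at h4
  rw [inner_neg_left, real_inner_smul_left, inner_sub_left]
  have h8 : ‖dx + (2 * r)⁻¹ • dv‖ ≤ C * √(‖dx‖ ^ 2 + ‖dv‖ ^ 2) := by
    have h9 : ‖dx‖ ≤ √(‖dx‖ ^ 2 + ‖dv‖ ^ 2) :=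
      Real.le_sqrt_of_sq_le (by nlinarith [sq_nonneg ‖dv‖])
    have h10 : ‖dv‖ ≤ √(‖dx‖ ^ 2 + ‖dv‖ ^ 2) :=
      Real.le_sqrt_of_sq_le (by nlinarith [sq_nonneg ‖dx‖])
    refine (norm_add_le _ _).trans ?_
    rw [norm_smul, Real.norm_of_nonneg (by positivity), hC, add_mul, one_mul]
    gcongr
  have h9 : ε / C * ‖dx + (2 * r)⁻¹ • dv‖ ≤ ε * √(‖dx‖ ^ 2 + ‖dv‖ ^ 2) := by
    calc _ ≤ ε / C * (C * √(‖dx‖ ^ 2 + ‖dv‖ ^ 2)) := by gcongr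
      _ = _ := by field_simp
  linarith

/-- A lower bound on the limiting coderivative bounds the growth of `P` near the base point. -/
lemma exists_inner_le [FiniteDimensional ℝ X] (h : IsProxLocalization g xb vh r P R ρ δ)
    (hvh : vh ∈ limSubdiff g xb) {r' : ℝ} (hr' : r' < 2 * r)
    (hcod : ∀ w z : X, w ≠ 0 → z ∈ limCoderiv (limSubdiff g) xb vh w →
      -r' * ‖w‖ ^ 2 < ⟪z, w⟫) :
    ∃ η > 0, ∀ y₀ ∈ ball (xb + (2 * r)⁻¹ • vh) η, ∀ y₁ ∈ ball (xb + (2 * r)⁻¹ • vh) η,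
      ⟪P y₁ - P y₀, y₁ - y₀⟫ ≤ (1 - r' / (2 * r))⁻¹ * ‖y₁ - y₀‖ ^ 2 := by
  have hr := h.r_pos
  have hρ := h.ρ_pos
  set yb := xb + (2 * r)⁻¹ • vh with hyb
  have hμ : 0 < 1 - r' / (2 * r) := by
    rw [sub_pos, div_lt_one (by positivity)]; exact hr'
  set μ := 1 - r' / (2 * r) with hμdef
  have hPb : P yb = xb := h.apply_base hvh
  have hybb : yb ∈ ball yb ρ := mem_ball_self hρ
  by_contra! hcon
  -- violating points produce unit-direction supergradients arbitrarily close to `yb`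
  have hstep : ∀ n : ℕ, ∃ y a s : X, dist y yb < min ρ (1 / (n + 1)) ∧ ‖a‖ = 1 ∧ ‖s‖ ≤ 4 ∧
      μ⁻¹ ≤ ⟪s, a⟫ ∧
      ∀ ε > 0, ∀ᶠ y' in 𝓝 y, ⟪a, P y' - P y⟫ ≤ ⟪s, y' - y⟫ + ε * ‖y' - y‖ := by
    intro n
    set σ := min ρ (1 / ((n:ℝ) + 1)) with hσ
    have hσpos : 0 < σ := by positivity
    obtain ⟨y₀, h₀, y₁, h₁, hlt⟩ := hcon (σ / 2) (by positivity)
    have hsub : ball yb σ ⊆ ball yb ρ := ball_subset_ball (min_le_left _ _)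
    obtain ⟨y, hy, s, hs1, hs2, hs3⟩ := exists_subgradient_of_lt_inner (L := 2) (by norm_num)
      (fun y hy y' hy' => h.norm_sub_le (hsub hy) (hsub hy')) h₀ h₁ hlt
    set d := y₁ - y₀ with hd
    have hd0 : 0 < ‖d‖ := by
      refine norm_pos_iff.2 fun h0 => ?_
      rw [h0] at hlt
      simp at hlt
    refine ⟨y, (-‖d‖⁻¹) • d, (-‖d‖⁻¹) • s, hy, ?_, ?_, ?_, ?_⟩
    · rw [norm_smul, norm_neg, norm_inv, norm_norm, inv_mul_cancel₀ hd0.ne']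
    · rw [norm_smul, norm_neg, norm_inv, norm_norm, inv_mul_le_iff₀ hd0]; linarith
    · rw [real_inner_smul_left, real_inner_smul_right]
      have e : -‖d‖⁻¹ * (-‖d‖⁻¹ * ⟪s, d⟫) = ⟪s, d⟫ / ‖d‖ ^ 2 := by field_simp
      rw [e, le_div_iff₀ (by positivity)]
      exact hs2
    · intro ε hε
      filter_upwards [hs3 (ε * ‖d‖) (by positivity)] with y' hy'
      rw [real_inner_smul_left, real_inner_smul_left, real_inner_comm]
      have e : ‖d‖⁻¹ * (⟪s, y' - y⟫ - ε * ‖d‖ * ‖y' - y‖)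
          = ‖d‖⁻¹ * ⟪s, y' - y⟫ - ε * ‖y' - y‖ := by field_simp
      have := mul_le_mul_of_nonneg_left hy' (inv_nonneg.2 hd0.le)
      rw [e] at this
      linarith
  choose ys as ss hys has hss hsa hsup using hstep
  have hylim : Tendsto ys atTop (𝓝 yb) := by
    refine tendsto_iff_dist_tendsto_zero.2 (squeeze_zero (fun _ => dist_nonneg)
      (fun n => ((hys n).trans_le (min_le_right _ _)).le) tendsto_one_div_add_atTop_nhds_zero_nat)
  obtain ⟨⟨a, s⟩, -, φ, hφ, hlim⟩ :=
    ((isCompact_closedBall (0:X) 1).prod (isCompact_closedBall (0:X) 4)).tendsto_subseq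
      (x := fun n => (as n, ss n))
      (fun n => ⟨by simpa using (has n).le, by simpa using hss n⟩)
  have hal : Tendsto (fun n => as (φ n)) atTop (𝓝 a) := (continuous_fst.tendsto _).comp hlim
  have hsl : Tendsto (fun n => ss (φ n)) atTop (𝓝 s) := (continuous_snd.tendsto _).comp hlim
  have hyl : Tendsto (fun n => ys (φ n)) atTop (𝓝 yb) := hylim.comp hφ.tendsto_atTop
  have hPl : Tendsto (fun n => P (ys (φ n))) atTop (𝓝 xb) := by
    have := (h.continuousAt hybb).tendsto.comp hyl
    rwa [hPb] at this
  have hvl : Tendsto (fun n => (2 * r) • (ys (φ n) - P (ys (φ n)))) atTop (𝓝 vh) := by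
    have := (hyl.sub hPl).const_smul (2 * r)
    rwa [hyb, add_sub_cancel_left, smul_smul, mul_inv_cancel₀ (by positivity), one_smul] at this
  have ha1 : ‖a‖ = 1 :=
    tendsto_nhds_unique hal.norm (by simp only [has]; exact tendsto_const_nhds)
  have hsa' : μ⁻¹ ≤ ⟪s, a⟫ := ge_of_tendsto (hsl.inner hal) (Eventually.of_forall fun n => hsa _)
  have hmem : a - s ∈ limCoderiv (limSubdiff g) xb vh ((2 * r)⁻¹ • s) := by
    have hev : ∀ᶠ n in atTop, P (ys (φ n)) ∈ ball xb δ ∧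
        (2 * r) • (ys (φ n) - P (ys (φ n))) ∈ ball vh δ :=
      (hPl.eventually (ball_mem_nhds _ h.δ_pos)).and (hvl.eventually (ball_mem_nhds _ h.δ_pos))
    obtain ⟨N, hN⟩ := eventually_atTop.1 hev
    have hyρ : ∀ n, ys n ∈ ball yb ρ := fun n => (hys n).trans_le (min_le_left _ _)
    refine ⟨fun n => (P (ys (φ (n + N))), (2 * r) • (ys (φ (n + N)) - P (ys (φ (n + N))))),
      fun n => (as (φ (n + N)) - ss (φ (n + N)), -((2 * r)⁻¹ • ss (φ (n + N)))),
      fun n => h.mem_limSubdiff _ (hyρ _), ?_, fun n => ?_, ?_⟩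
    · exact (tendsto_add_atTop_iff_nat N).2 (hPl.prodMk_nhds hvl)
    · obtain ⟨h1, h2⟩ := hN (n + N) (Nat.le_add_left _ _)
      exact h.mem_regNC2 (by simpa [dist_eq_norm] using h1)
        (by simpa [dist_eq_norm] using h2) (hsup _)
    · exact (tendsto_add_atTop_iff_nat N).2
        ((hal.sub hsl).prodMk_nhds (hsl.const_smul ((2 * r)⁻¹)).neg)
  have hs0 : s ≠ 0 := by
    rintro rfl
    rw [inner_zero_left] at hsa'
    exact absurd hsa' (not_le.2 (by positivity))
  have h1 := hcod _ _ (smul_ne_zero (by positivity) hs0) hmem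
  rw [real_inner_smul_right, inner_sub_left, real_inner_self_eq_norm_sq, norm_smul,
    Real.norm_of_nonneg (by positivity), real_inner_comm] at h1
  have h2 : ⟪s, a⟫ ≤ ‖s‖ := by
    have := real_inner_le_norm s a
    rwa [ha1, mul_one] at this
  have h3 : μ * ‖s‖ ^ 2 < ⟪s, a⟫ := by
    have e : -r' * ((2 * r)⁻¹ * ‖s‖) ^ 2 = (2 * r)⁻¹ * (-(r' / (2 * r)) * ‖s‖ ^ 2) := by
      field_simp
    rw [e] at h1
    have := lt_of_mul_lt_mul_left h1 (by positivity)
    rw [hμdef]; linarith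
  have h4 : 1 ≤ μ * ‖s‖ := by
    have := hsa'.trans h2
    rwa [inv_le_iff_one_le_mul₀ hμ, mul_comm] at this
  have h5 : 0 < ‖s‖ := norm_pos_iff.2 hs0
  nlinarith

/-- The quadratic upper bound for the conjugate function `y ↦ 2 r ⟪y, P y⟫ - g (P y) - r ‖P y‖²`,
whose gradient is `2 r P`. -/
lemma conjugate_le (h : IsProxLocalization g xb vh r P R ρ δ) {η M : ℝ} (hηρ : η ≤ ρ)
    (hM : ∀ y₀ ∈ ball (xb + (2 * r)⁻¹ • vh) η, ∀ y₁ ∈ ball (xb + (2 * r)⁻¹ • vh) η,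
      ⟪P y₁ - P y₀, y₁ - y₀⟫ ≤ M * ‖y₁ - y₀‖ ^ 2) {y y' : X}
    (hy : y ∈ ball (xb + (2 * r)⁻¹ • vh) η) (hy' : y' ∈ ball (xb + (2 * r)⁻¹ • vh) η) :
    2 * r * ⟪y', P y'⟫ - (g (P y')).toReal - r * ‖P y'‖ ^ 2 ≤
      2 * r * ⟪y, P y⟫ - (g (P y)).toReal - r * ‖P y‖ ^ 2 + 2 * r * ⟪P y, y' - y⟫
        + r * M * ‖y' - y‖ ^ 2 := by
  have hr := h.r_pos
  set B := ball (xb + (2 * r)⁻¹ • vh) η with hB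
  have hBρ : B ⊆ ball (xb + (2 * r)⁻¹ • vh) ρ := ball_subset_ball hηρ
  set Φ : X → ℝ := fun y => 2 * r * ⟪y, P y⟫ - (g (P y)).toReal - r * ‖P y‖ ^ 2 with hΦ
  have hsubgrad : ∀ a ∈ B, ∀ b ∈ B, Φ a + 2 * r * ⟪P a, b - a⟫ ≤ Φ b := by
    intro a ha b hb
    have h1 := h.le b (hBρ hb) (P a) (h.mem_ball a (hBρ ha)) (h.ne_top a (hBρ ha))
    simp only [hΦ]
    have e1 : ⟪b - P b, P a - P b⟫ = ⟪b, P a⟫ - ⟪b, P b⟫ - ⟪P a, P b⟫ + ‖P b‖ ^ 2 := by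
      rw [inner_sub_left, inner_sub_right, inner_sub_right, real_inner_self_eq_norm_sq,
        real_inner_comm (P a) (P b)]
      ring
    have e2 := norm_sub_sq_real (P a) (P b)
    have e3 : ⟪P a, b - a⟫ = ⟪b, P a⟫ - ⟪a, P a⟫ := by
      rw [inner_sub_right, real_inner_comm b, real_inner_comm a]
    rw [e1, e2] at h1
    rw [e3]
    have h2 : 0 ≤ r / 2 * ‖P a - P b‖ ^ 2 := by positivity
    rw [e2] at h2
    linarith
  have hquad : ∀ a ∈ B, ∀ b ∈ B, |Φ b - Φ a - 2 * r * ⟪P a, b - a⟫| ≤ 4 * r * ‖b - a‖ ^ 2 := by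
    intro a ha b hb
    have h1 := hsubgrad a ha b hb
    have h2 := hsubgrad b hb a ha
    have e1 : ⟪P b, a - b⟫ = -⟪P b, b - a⟫ := by rw [← inner_neg_right, neg_sub]
    have h3 : ⟪P b, b - a⟫ - ⟪P a, b - a⟫ ≤ 2 * ‖b - a‖ * ‖b - a‖ := by
      rw [← inner_sub_left]
      exact (real_inner_le_norm _ _).trans (by gcongr; exact h.norm_sub_le (hBρ hb) (hBρ ha))
    rw [e1] at h2
    rw [abs_of_nonneg (by linarith)]
    nlinarith
  set d := y' - y with hd
  have hseg : ∀ t ∈ Icc (0:ℝ) 1, y + t • d ∈ B := by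
    intro t ht
    refine (convex_ball _ η).segment_subset hy hy' ?_
    rw [segment_eq_image']
    exact ⟨t, ht, rfl⟩
  have hline : ∀ t : ℝ, HasDerivAt (fun t : ℝ => y + t • d) d t := fun t => by
    simpa using ((hasDerivAt_id t).smul_const d).const_add y
  have hderiv : ∀ t ∈ Icc (0:ℝ) 1,
      HasDerivAt (fun t : ℝ => Φ (y + t • d)) (2 * r * ⟪P (y + t • d), d⟫) t := by
    intro t ht
    rw [hasDerivAt_iff_isLittleO]
    refine Asymptotics.IsBigO.trans_isLittleO ?_
      (Asymptotics.isLittleO_pow_sub_sub t (m := 2) one_lt_two)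
    refine Asymptotics.IsBigO.of_bound (4 * r * ‖d‖ ^ 2) ?_
    filter_upwards [(hline t).continuousAt.eventually (isOpen_ball.mem_nhds (hseg t ht))]
      with t' ht'
    have h1 := hquad _ (hseg t ht) _ ht'
    have e1 : y + t' • d - (y + t • d) = (t' - t) • d := by rw [sub_smul]; abel
    rw [e1, real_inner_smul_right, norm_smul, mul_pow] at h1
    rw [Real.norm_eq_abs, smul_eq_mul, norm_pow, norm_norm]
    convert h1 using 1
    · congr 1; ring
    · ring
  have hfd : ∀ t ∈ Icc (0:ℝ) 1, HasDerivAt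
      (fun t : ℝ => Φ (y + t • d) - t * (2 * r * ⟪P y, d⟫) - t ^ 2 * (r * M * ‖d‖ ^ 2))
      (2 * r * ⟪P (y + t • d), d⟫ - 2 * r * ⟪P y, d⟫ - 2 * t * (r * M * ‖d‖ ^ 2)) t := by
    intro t ht
    have h1 := (hasDerivAt_id t).mul_const (2 * r * ⟪P y, d⟫)
    have h2 := (hasDerivAt_pow 2 t).mul_const (r * M * ‖d‖ ^ 2)
    exact (((hderiv t ht).sub h1).sub h2).congr_deriv (by simp)
  have hanti := antitoneOn_of_deriv_nonpos (convex_Icc (0:ℝ) 1)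
    (fun t ht => (hfd t ht).continuousAt.continuousWithinAt)
    (fun t ht => (hfd t (interior_subset ht)).differentiableAt.differentiableWithinAt)
    (fun t ht => by
      rw [interior_Icc] at ht
      rw [(hfd t (Ioo_subset_Icc_self ht)).deriv]
      have h1 := hM y hy _ (hseg t (Ioo_subset_Icc_self ht))
      rw [add_sub_cancel_left, real_inner_smul_right, norm_smul, Real.norm_of_nonneg ht.1.le,
        inner_sub_left] at h1
      have h2 : t * (⟪P (y + t • d), d⟫ - ⟪P y, d⟫) ≤ t * (t * (M * ‖d‖ ^ 2)) := by
        nlinarith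
      have h3 := le_of_mul_le_mul_left h2 ht.1
      nlinarith)
  have h01 := hanti (left_mem_Icc.2 zero_le_one) (right_mem_Icc.2 zero_le_one) zero_le_one
  simp only [one_smul, zero_smul, add_zero, one_mul, one_pow, zero_mul, ne_eq,
    OfNat.ofNat_ne_zero, not_false_eq_true, zero_pow, sub_zero] at h01
  have e : y + d = y' := by rw [hd]; abel
  rw [e] at h01
  simp only [hΦ] at h01
  linarith

/-- A strict lower bound `-r'` on the limiting coderivative yields prox-regularity with
parameter `r'`. -/
lemma proxRegWithNP [FiniteDimensional ℝ X] (h : IsProxLocalization g xb vh r P R ρ δ)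
    (hg : ∀ x, g x ≠ ⊥) (hvh : vh ∈ limSubdiff g xb) {r' : ℝ} (hr' : r' < 2 * r)
    (hcod : ∀ w z : X, w ≠ 0 → z ∈ limCoderiv (limSubdiff g) xb vh w →
      -r' * ‖w‖ ^ 2 < ⟪z, w⟫) :
    ProxRegWithNP g xb vh r' := by
  have hr := h.r_pos
  have hρ := h.ρ_pos
  have hδ := h.δ_pos
  have hR := h.R_pos
  obtain ⟨η, hη, hM⟩ := h.exists_inner_le hvh hr' hcod
  have hμ : 0 < 1 - r' / (2 * r) := by
    rw [sub_pos, div_lt_one (by positivity)]; exact hr'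
  set μ := 1 - r' / (2 * r) with hμdef
  set yb := xb + (2 * r)⁻¹ • vh with hyb
  set σ := min η ρ with hσ
  have hσpos : 0 < σ := lt_min hη hρ
  have hση : ball yb σ ⊆ ball yb η := ball_subset_ball (min_le_left _ _)
  have hσρ : ball yb σ ⊆ ball yb ρ := ball_subset_ball (min_le_right _ _)
  set C := 1 + (2 * r)⁻¹ + 2 * μ with hC
  have hCpos : 0 < C := by positivity
  refine ⟨min (min δ R) (σ / C), by positivity, fun x u v hx hu hv huv _ => ?_⟩
  have hxR : ‖x - xb‖ < R := hx.trans_le ((min_le_left _ _).trans (min_le_right _ _))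
  have huδ : ‖u - xb‖ < δ := hu.trans_le ((min_le_left _ _).trans (min_le_left _ _))
  have hvδ : ‖v - vh‖ < δ := hv.trans_le ((min_le_left _ _).trans (min_le_left _ _))
  set ε := σ / C with hε
  have hεC : C * ε = σ := by rw [hε]; field_simp
  have hxε : ‖x - xb‖ < ε := hx.trans_le (min_le_right _ _)
  have huε : ‖u - xb‖ < ε := hu.trans_le (min_le_right _ _)
  have hvε : ‖v - vh‖ < ε := hv.trans_le (min_le_right _ _)
  have hεpos : 0 < ε := (norm_nonneg _).trans_lt hxε
  obtain ⟨hyρ, hPy⟩ := h.param u v huδ hvδ huv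
  set y := u + (2 * r)⁻¹ • v with hy
  have hvy : v = (2 * r) • (y - u) := by
    rw [hy, add_sub_cancel_left, smul_smul, mul_inv_cancel₀ (by positivity), one_smul]
  by_cases hxt : g x = ⊤
  · rw [hxt]; exact le_top
  have hut : g u ≠ ⊤ := by rw [← hPy]; exact h.ne_top y hyρ
  rw [coe_add_le_iff_toReal hut (hg u) hxt (hg x)]
  set y' := y + μ • (x - u) with hy'
  have hyyb : ‖y - yb‖ ≤ (1 + (2 * r)⁻¹) * ε := by
    have e : y - yb = (u - xb) + (2 * r)⁻¹ • (v - vh) := by rw [hy, hyb, smul_sub]; abel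
    rw [e, add_mul, one_mul]
    refine (norm_add_le _ _).trans (add_le_add huε.le ?_)
    rw [norm_smul, Real.norm_of_nonneg (by positivity)]
    gcongr
  have hyσ : y ∈ ball yb σ := by
    rw [Metric.mem_ball, dist_eq_norm, ← hεC]
    refine hyyb.trans_lt ?_
    have : 0 < 2 * μ * ε := by positivity
    rw [hC, add_mul]; linarith
  have hy'σ : y' ∈ ball yb σ := by
    rw [Metric.mem_ball, dist_eq_norm, ← hεC]
    have e : y' - yb = (y - yb) + μ • ((x - xb) - (u - xb)) := by
      rw [hy', sub_sub_sub_cancel_right]; abel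
    rw [e]
    refine (norm_add_le _ _).trans_lt ?_
    rw [norm_smul, Real.norm_of_nonneg hμ.le]
    have h1 : ‖(x - xb) - (u - xb)‖ < 2 * ε := (_root_.norm_sub_le _ _).trans_lt (by linarith)
    have h2 : μ * ‖(x - xb) - (u - xb)‖ < μ * (2 * ε) := by gcongr
    rw [hC, add_mul]; linarith
  have h1 := h.conjugate_le (min_le_right η ρ) (M := μ⁻¹)
    (fun a ha b hb => hM a (hση ha) b (hση hb)) hyσ hy'σ
  have h2 := h.le y' (hσρ hy'σ) x (by simpa [dist_eq_norm] using hxR) hxt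
  rw [hPy] at h1
  set p := P y' with hp
  have e0 : y' - y = μ • (x - u) := by rw [hy']; abel
  have e1 : ⟪y' - p, x - p⟫ = ⟪y', x⟫ - ⟪y', p⟫ - ⟪x, p⟫ + ‖p‖ ^ 2 := by
    rw [inner_sub_left, inner_sub_right, inner_sub_right, real_inner_self_eq_norm_sq,
      real_inner_comm x p]
    ring
  have e2 := norm_sub_sq_real x p
  have e3 : ⟪y', x⟫ = ⟪y, x⟫ + μ * (‖x‖ ^ 2 - ⟪x, u⟫) := by
    rw [hy', inner_add_left, real_inner_smul_left, inner_sub_left, real_inner_self_eq_norm_sq,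
      real_inner_comm x u]
  have e4 : ⟪u, y' - y⟫ = μ * (⟪x, u⟫ - ‖u‖ ^ 2) := by
    rw [e0, real_inner_smul_right, inner_sub_right, real_inner_self_eq_norm_sq,
      real_inner_comm x u]
  have e5 : μ⁻¹ * ‖y' - y‖ ^ 2 = μ * ‖x - u‖ ^ 2 := by
    rw [e0, norm_smul, Real.norm_of_nonneg hμ.le]; field_simp
  have e6 := norm_sub_sq_real x u
  have e7 : ⟪v, x - u⟫ = 2 * r * (⟪y, x⟫ - ⟪y, u⟫ - ⟪x, u⟫ + ‖u‖ ^ 2) := by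
    rw [hvy, real_inner_smul_left, inner_sub_left, inner_sub_right, inner_sub_right,
      real_inner_self_eq_norm_sq, real_inner_comm x u]
    ring
  have e8 : r' = 2 * r * (1 - μ) := by rw [hμdef]; field_simp; ring
  have h3 : 0 ≤ r / 2 * ‖x - p‖ ^ 2 := by positivity
  rw [mul_assoc r, e5, e4, e6] at h1
  rw [e1, e2, e3] at h2
  rw [e2] at h3
  rw [e7, e8, e6]
  nlinarith

end IsProxLocalization

/-- pointbased formula for the threshold of prox-regularity in
finite dimensions (Theorem 5.4). -/
theorem statement5
    {X : Type*} [NormedAddCommGroup X] [InnerProductSpace ℝ X] [FiniteDimensional ℝ X]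
    (g : X → EReal) (xb vh : X)
    (hg_lsc : LowerSemicontinuous g)
    (hg_proper : ∀ x, g x ≠ ⊥)
    (hvh : vh ∈ limSubdiff g xb)
    (hpr : ∃ r > (0:ℝ), ProxRegWithNP g xb vh r)
    (hsc : SubdiffContNP g xb vh)
    (τ₀ : EReal)
    (hτ₀ : τ₀ = sInf {b : EReal | ∃ w z : X, w ≠ 0 ∧
        z ∈ limCoderiv (limSubdiff g) xb vh w ∧ b = ((⟪z, w⟫ / ‖w‖ ^ 2 : ℝ) : EReal)}) :
    τ₀ ≠ ⊥ ∧ (proxThresholdNP g xb vh : EReal) = max 0 (-τ₀) := by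
  obtain ⟨r₀, hr₀, hpr₀⟩ := hpr
  obtain ⟨P, R, ρ, δ, hP⟩ := exists_isProxLocalization hg_lsc hg_proper hvh hr₀ hpr₀ hsc
  have hlow : ∀ r : ℝ, 0 < r → ProxRegWithNP g xb vh r → ((-r : ℝ) : EReal) ≤ τ₀ := by
    intro r hr hpr
    obtain ⟨P, R, ρ, δ, hP⟩ := exists_isProxLocalization hg_lsc hg_proper hvh hr hpr hsc
    rw [hτ₀]
    refine le_sInf ?_
    rintro b ⟨w, z, hw, hz, rfl⟩
    rw [EReal.coe_le_coe_iff, le_div_iff₀ (by positivity)]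
    exact hP.neg_le_inner_of_mem_limCoderiv hz
  have hbdd : BddBelow {r : ℝ | 0 < r ∧ ProxRegWithNP g xb vh r} := ⟨0, fun r hr => hr.1.le⟩
  have hne : {r : ℝ | 0 < r ∧ ProxRegWithNP g xb vh r}.Nonempty := ⟨r₀, hr₀, hpr₀⟩
  have hup : ∀ q : ℝ, 0 < q → ((-q : ℝ) : EReal) < τ₀ → proxThresholdNP g xb vh ≤ q := by
    intro q hq hqτ
    refine csInf_le hbdd ⟨hq, ?_⟩
    rcases le_or_gt (2 * r₀) q with h | h
    · exact hpr₀.mono (by linarith)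
    · refine hP.proxRegWithNP hg_proper hvh h fun w z hw hz => ?_
      have h1 : ((-q : ℝ) : EReal) < ((⟪z, w⟫ / ‖w‖ ^ 2 : ℝ) : EReal) :=
        hqτ.trans_le (hτ₀ ▸ sInf_le ⟨w, z, hw, hz, rfl⟩)
      rwa [EReal.coe_lt_coe_iff, lt_div_iff₀ (by positivity)] at h1
  have hnonneg : 0 ≤ proxThresholdNP g xb vh := Real.sInf_nonneg fun r hr => hr.1.le
  have hbot : τ₀ ≠ ⊥ := fun h => by simpa [h] using hlow r₀ hr₀ hpr₀
  refine ⟨hbot, ?_⟩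
  clear hτ₀
  induction τ₀ with
  | bot => exact absurd rfl hbot
  | top =>
    have h0 : proxThresholdNP g xb vh = 0 :=
      le_antisymm (le_of_forall_gt_imp_ge_of_dense fun q hq => hup q hq (EReal.coe_lt_top _))
        hnonneg
    simp [h0]
  | coe t =>
    rw [← EReal.coe_neg, ← EReal.coe_zero, ← EReal.coe_strictMono.monotone.map_max,
      EReal.coe_eq_coe_iff]
    refine le_antisymm (le_of_forall_gt_imp_ge_of_dense fun q hq => ?_) (max_le hnonneg ?_)
    · obtain ⟨hq0, hqt⟩ := max_lt_iff.1 hq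
      exact hup q hq0 (EReal.coe_lt_coe_iff.2 (by linarith))
    · refine le_csInf hne fun r hr => ?_
      have := EReal.coe_le_coe_iff.1 (hlow r hr.1 hr.2)
      linarith

end PVS
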